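/- Let K be a field of characteristic 0 and σ a pointed full-dimensional rational polyhedral cone in N_ℚ. Two nonzero homogeneous locally nilpotent derivations ∂ = λ∂_{ρ,e} and ∂' = λ'∂_{ρ',e'} on A = K[σ^∨ ∩ M] have equal kernels if and only if ρ = ρ'. In particular, the number of kernels of nonzero homogeneous locally nilpotent derivations on A is finite, equal to the number of extremal rays of σ. -/

import Mathlib

open scoped BigOperators Pointwise

noncomputable section

/-- Rational `n`-space `N_ℚ ≅ M_ℚ ≅ ℚⁿ`. -/
abbrev Vec (n : ℕ) := Fin n → ℚ

/-- The natural pairing `M_ℚ × N_ℚ → ℚ`. -/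
def pairQ {n : ℕ} (m p : Vec n) : ℚ := ∑ i, m i * p i

/-- The dual cone of a subset of `N_ℚ`. -/
def dualCone {n : ℕ} (σ : Set (Vec n)) : Set (Vec n) :=
  {m | ∀ p ∈ σ, 0 ≤ pairQ m p}

/-- Inclusion of the lattice `M = ℤⁿ` into `M_ℚ`. -/
def toQ {n : ℕ} (v : Fin n → ℤ) : Vec n := fun i => (v i : ℚ)

/-- A vector of `ℚⁿ` is a lattice vector if all its coordinates are integers. -/
def IsLatticeVec {n : ℕ} (v : Vec n) : Prop := ∀ i, ∃ z : ℤ, v i = (z : ℚ)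

/-- The convex cone generated by a set: all finite nonnegative rational combinations. -/
def coneHull {n : ℕ} (S : Set (Vec n)) : Set (Vec n) :=
  {x | ∃ (G : Finset (Vec n)) (c : Vec n → ℚ), ↑G ⊆ S ∧ (∀ g, 0 ≤ c g) ∧
    x = ∑ g ∈ G, c g • g}

/-- A rational polyhedral cone: the cone generated by finitely many lattice vectors. -/
def IsRatPolyCone {n : ℕ} (σ : Set (Vec n)) : Prop :=
  ∃ G : Finset (Vec n), (∀ g ∈ G, IsLatticeVec g) ∧ σ = coneHull ↑G

/-- A cone is pointed if it contains no line through the origin. -/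
def PointedCone' {n : ℕ} (σ : Set (Vec n)) : Prop := σ ∩ (-σ) ⊆ {0}

/-- A cone is of full dimension if it spans the ambient space. -/
def FullDim {n : ℕ} (σ : Set (Vec n)) : Prop := Submodule.span ℚ σ = ⊤

/-- `ρ` is the extremal ray of `σ` generated by the primitive lattice vector `ν`. -/
def IsExtremalRay {n : ℕ} (σ ρ : Set (Vec n)) (ν : Vec n) : Prop :=
  IsLatticeVec ν ∧ ν ≠ 0 ∧ (∀ c : ℚ, 0 < c → IsLatticeVec (c • ν) → 1 ≤ c) ∧
  ρ = {x | ∃ c : ℚ, 0 ≤ c ∧ x = c • ν} ∧ ρ ⊆ σ ∧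
  (∀ x ∈ σ, ∀ y ∈ σ, x + y ∈ ρ → x ∈ ρ)

/-- The submonoid `σ^∨ ∩ M` of lattice points of the dual cone. -/
def latticeCone {n : ℕ} (σ : Set (Vec n)) : AddSubmonoid (Fin n → ℤ) where
  carrier := {m | toQ m ∈ dualCone σ}
  zero_mem' := by
    intro p hp
    simp [pairQ, toQ]
  add_mem' := by
    intro a b ha hb p hp
    have h : pairQ (toQ (a + b)) p = pairQ (toQ a) p + pairQ (toQ b) p := by
      simp [pairQ, toQ, add_mul, Finset.sum_add_distrib]
    rw [h]
    exact add_nonneg (ha p hp) (hb p hp)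

/-- A derivation is locally nilpotent if every element is annihilated by some iterate. -/
def IsLND {R A : Type*} [CommRing R] [CommRing A] [Algebra R A]
    (D : Derivation R A A) : Prop :=
  ∀ a : A, ∃ k : ℕ, (⇑D)^[k] a = 0



section Pairing

variable {n : ℕ}

theorem pairQ_add_left (a b p : Vec n) : pairQ (a + b) p = pairQ a p + pairQ b p :=
  add_dotProduct a b p

theorem pairQ_add_right (m p q : Vec n) : pairQ m (p + q) = pairQ m p + pairQ m q :=
  dotProduct_add m p q

theorem pairQ_sub_left (a b p : Vec n) : pairQ (a - b) p = pairQ a p - pairQ b p :=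
  sub_dotProduct a b p

theorem pairQ_sub_right (m p q : Vec n) : pairQ m (p - q) = pairQ m p - pairQ m q :=
  dotProduct_sub m p q

theorem pairQ_neg_right (m p : Vec n) : pairQ m (-p) = -pairQ m p :=
  dotProduct_neg m p

theorem pairQ_smul_left (c : ℚ) (m p : Vec n) : pairQ (c • m) p = c * pairQ m p :=
  smul_dotProduct c m p

theorem pairQ_smul_right (c : ℚ) (m p : Vec n) : pairQ m (c • p) = c * pairQ m p :=
  dotProduct_smul c m p

theorem pairQ_sum_right {ι : Type*} (m : Vec n) (s : Finset ι) (f : ι → Vec n) :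
    pairQ m (∑ i ∈ s, f i) = ∑ i ∈ s, pairQ m (f i) :=
  dotProduct_sum m s f

theorem toQ_add (a b : Fin n → ℤ) : toQ (a + b) = toQ a + toQ b := by
  ext i; simp [toQ]

theorem toQ_nsmul (k : ℕ) (a : Fin n → ℤ) : toQ (k • a) = (k : ℚ) • toQ a := by
  ext i; simp [toQ]

theorem pairQ_toQ (z w : Fin n → ℤ) : pairQ (toQ z) (toQ w) = ((z ⬝ᵥ w : ℤ) : ℚ) := by
  simp [pairQ, toQ, dotProduct]

theorem IsLatticeVec.exists_toQ {v : Vec n} (hv : IsLatticeVec v) : ∃ w, toQ w = v := by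
  choose w hw using hv
  exact ⟨w, funext fun i => (hw i).symm⟩

theorem isLatticeVec_toQ (w : Fin n → ℤ) : IsLatticeVec (toQ w) := fun i => ⟨w i, rfl⟩

theorem exists_nat_smul_eq_toQ (v : Vec n) :
    ∃ (N : ℕ) (z : Fin n → ℤ), 0 < N ∧ toQ z = (N : ℚ) • v := by
  have hdvd (i : Fin n) : (v i).den ∣ ∏ j, (v j).den := Finset.dvd_prod_of_mem _ (Finset.mem_univ i)
  choose k hk using hdvd
  refine ⟨∏ j, (v j).den, fun i => k i * (v i).num, Finset.prod_pos fun i _ => (v i).pos, ?_⟩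
  ext i
  have h : (v i).den * v i = (v i).num := by rw [mul_comm]; exact Rat.mul_den_eq_num _
  simp only [toQ, Pi.smul_apply, smul_eq_mul]
  rw [hk i]
  push_cast
  rw [← h]; ring

end Pairing

section Cone

variable {n : ℕ}

/-- Farkas' lemma: a vector outside a finitely generated cone is separated from it. -/
theorem exists_pairQ_neg_of_not_mem_cone {ι : Type*} (s : Finset ι) (v : ι → Vec n) (b : Vec n)
    (hb : ¬ ∃ c : ι → ℚ, (∀ i, 0 ≤ c i) ∧ b = ∑ i ∈ s, c i • v i) :
    ∃ m, (∀ i ∈ s, 0 ≤ pairQ m (v i)) ∧ pairQ m b < 0 := by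
  classical
  induction s using Finset.induction_on generalizing v b with
  | empty =>
    refine ⟨-b, by simp, ?_⟩
    have hb0 : b ≠ 0 := fun h => hb ⟨0, by simp, by simp [h]⟩
    have : 0 < b ⬝ᵥ b := lt_of_le_of_ne
      (Finset.sum_nonneg fun i _ => mul_self_nonneg _) (fun h => hb0 (dotProduct_self_eq_zero.1 h.symm))
    have h2 : pairQ (-b) b = -(b ⬝ᵥ b) := neg_dotProduct b b
    linarith
  | insert j s hj ih =>
    obtain ⟨φ, hφ, hφb⟩ := ih v b fun ⟨c, hc, h⟩ => hb ⟨Function.update c j 0, fun i => by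
        by_cases hi : i = j
        · simp [hi]
        · simpa [hi] using hc i, by
        rw [Finset.sum_insert hj, h]
        simp only [Function.update_self, zero_smul, zero_add]
        refine Finset.sum_congr rfl fun i hi => ?_
        rw [Function.update_of_ne (ne_of_mem_of_not_mem hi hj)]⟩
    by_cases hφj : 0 ≤ pairQ φ (v j)
    · exact ⟨φ, by simpa [hφj] using hφ, hφb⟩
    push Not at hφj
    obtain ⟨ψ, hψ, hψb⟩ := ih (fun i => v i - (pairQ φ (v i) / pairQ φ (v j)) • v j)
      (b - (pairQ φ b / pairQ φ (v j)) • v j) fun ⟨c, hc, h⟩ => by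
        refine hb ⟨Function.update c j
          (pairQ φ b / pairQ φ (v j) - ∑ i ∈ s, c i * (pairQ φ (v i) / pairQ φ (v j))),
          fun i => ?_, ?_⟩
        · by_cases hi : i = j
          · subst hi
            rw [Function.update_self, sub_nonneg]
            refine (Finset.sum_nonpos fun k hk => ?_).trans (div_pos_of_neg_of_neg hφb hφj).le
            exact mul_nonpos_of_nonneg_of_nonpos (hc k)
              (div_nonpos_of_nonneg_of_nonpos (hφ k hk) hφj.le)
          · simpa [hi] using hc i
        · have hsum : ∑ i ∈ s, Function.update c j
              (pairQ φ b / pairQ φ (v j) - ∑ i ∈ s, c i * (pairQ φ (v i) / pairQ φ (v j))) i • v i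
              = ∑ i ∈ s, c i • v i := Finset.sum_congr rfl fun i hi => by
            rw [Function.update_of_ne (ne_of_mem_of_not_mem hi hj)]
          rw [Finset.sum_insert hj, hsum, Function.update_self]
          simp only [smul_sub, smul_smul, Finset.sum_sub_distrib, ← Finset.sum_smul] at h
          rw [sub_smul]
          linear_combination (exp := 1) h
    have key (x : Vec n) : pairQ (ψ - (pairQ ψ (v j) / pairQ φ (v j)) • φ) x =
        pairQ ψ (x - (pairQ φ x / pairQ φ (v j)) • v j) := by
      rw [pairQ_sub_left, pairQ_sub_right, pairQ_smul_left, pairQ_smul_right]; ring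
    refine ⟨ψ - (pairQ ψ (v j) / pairQ φ (v j)) • φ, fun i hi => ?_, by rwa [key]⟩
    rw [key]
    obtain rfl | hi := Finset.mem_insert.1 hi
    · rw [div_self hφj.ne, one_smul, sub_self]
      exact (dotProduct_zero ψ).ge
    · exact hψ i hi

theorem mem_coneHull_finset {G : Finset (Vec n)} {x : Vec n} :
    x ∈ coneHull (G : Set (Vec n)) ↔
      ∃ c : Vec n → ℚ, (∀ g, 0 ≤ c g) ∧ x = ∑ g ∈ G, c g • g := by
  classical
  constructor
  · rintro ⟨H, c, hH, hc, rfl⟩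
    refine ⟨fun g => if g ∈ H then c g else 0, fun g => ite_nonneg (hc g) le_rfl, ?_⟩
    simp only [ite_smul, zero_smul]
    rw [← Finset.sum_filter, Finset.filter_mem_eq_inter,
      Finset.inter_eq_right.2 (Finset.coe_subset.1 hH)]
  · rintro ⟨c, hc, rfl⟩
    exact ⟨G, c, subset_rfl, hc, rfl⟩

theorem IsRatPolyCone.zero_mem {σ : Set (Vec n)} (hσ : IsRatPolyCone σ) : 0 ∈ σ := by
  obtain ⟨G, -, rfl⟩ := hσ
  exact mem_coneHull_finset.2 ⟨0, by simp, by simp⟩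

theorem IsRatPolyCone.add_mem {σ : Set (Vec n)} (hσ : IsRatPolyCone σ) {x y : Vec n}
    (hx : x ∈ σ) (hy : y ∈ σ) : x + y ∈ σ := by
  obtain ⟨G, -, rfl⟩ := hσ
  obtain ⟨c, hc, rfl⟩ := mem_coneHull_finset.1 hx
  obtain ⟨d, hd, rfl⟩ := mem_coneHull_finset.1 hy
  exact mem_coneHull_finset.2 ⟨c + d, fun g => add_nonneg (hc g) (hd g), by
    simp [add_smul, Finset.sum_add_distrib]⟩

theorem IsRatPolyCone.smul_mem {σ : Set (Vec n)} (hσ : IsRatPolyCone σ) {x : Vec n} {t : ℚ}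
    (ht : 0 ≤ t) (hx : x ∈ σ) : t • x ∈ σ := by
  obtain ⟨G, -, rfl⟩ := hσ
  obtain ⟨c, hc, rfl⟩ := mem_coneHull_finset.1 hx
  exact mem_coneHull_finset.2 ⟨t • c, fun g => mul_nonneg ht (hc g), by
    simp [Finset.smul_sum, smul_smul]⟩

theorem mem_coneHull_of_mem {G : Finset (Vec n)} {g : Vec n} (hg : g ∈ G) :
    g ∈ coneHull (G : Set (Vec n)) :=
  ⟨{g}, 1, by simpa using hg, by simp, by simp⟩

theorem mem_dualCone_coneHull {G : Finset (Vec n)} {m : Vec n} :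
    m ∈ dualCone (coneHull (G : Set (Vec n))) ↔ ∀ g ∈ G, 0 ≤ pairQ m g := by
  refine ⟨fun h g hg => h g (mem_coneHull_of_mem hg), fun h p hp => ?_⟩
  obtain ⟨c, hc, rfl⟩ := mem_coneHull_finset.1 hp
  rw [pairQ_sum_right]
  refine Finset.sum_nonneg fun g hg => ?_
  rw [pairQ_smul_right]
  exact mul_nonneg (hc g) (h g hg)

theorem IsRatPolyCone.exists_latticeCone_neg {σ : Set (Vec n)} (hσ : IsRatPolyCone σ) {x : Vec n}
    (hx : x ∉ σ) : ∃ z ∈ latticeCone σ, pairQ (toQ z) x < 0 := by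
  obtain ⟨G, -, rfl⟩ := hσ
  obtain ⟨m, hm, hmx⟩ := exists_pairQ_neg_of_not_mem_cone G id x
    fun h => hx (mem_coneHull_finset.2 h)
  obtain ⟨N, z, hN, hz⟩ := exists_nat_smul_eq_toQ m
  have hN' : (0 : ℚ) < N := Nat.cast_pos.2 hN
  refine ⟨z, mem_dualCone_coneHull.2 fun g hg => ?_, ?_⟩
  · rw [hz, pairQ_smul_left]
    exact mul_nonneg hN'.le (hm g hg)
  · rw [hz, pairQ_smul_left]
    exact mul_neg_of_pos_of_neg hN' hmx

theorem IsRatPolyCone.mem_of_forall_latticeCone {σ : Set (Vec n)} (hσ : IsRatPolyCone σ)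
    {x : Vec n} (h : ∀ z ∈ latticeCone σ, 0 ≤ pairQ (toQ z) x) : x ∈ σ := by
  by_contra hx
  obtain ⟨z, hz, hzx⟩ := hσ.exists_latticeCone_neg hx
  exact (h z hz).not_gt hzx

theorem IsRatPolyCone.add_line {σ : Set (Vec n)} (hσ : IsRatPolyCone σ) {ν : Vec n}
    (hν : IsLatticeVec ν) : IsRatPolyCone {x | ∃ t : ℚ, 0 ≤ t ∧ x + t • ν ∈ σ} := by
  classical
  have hσ' := hσ
  obtain ⟨G, hG, hσG⟩ := hσ
  refine ⟨insert (-ν) G, fun g hg => ?_, Set.ext fun x => ⟨?_, fun hx => ?_⟩⟩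
  · obtain rfl | hg := Finset.mem_insert.1 hg
    · intro i
      obtain ⟨z, hz⟩ := hν i
      exact ⟨-z, by simp [hz]⟩
    · exact hG g hg
  · rintro ⟨t, ht, hx⟩
    have hsub : σ ⊆ coneHull ↑(insert (-ν) G) := by
      rintro _ hy
      rw [hσG] at hy
      obtain ⟨H, c, hH, hc, rfl⟩ := hy
      exact ⟨H, c, hH.trans (by simp), hc, rfl⟩
    have hcone : IsRatPolyCone (coneHull (↑(insert (-ν) G) : Set (Vec n))) :=
      ⟨insert (-ν) G, fun g hg => by
        obtain rfl | hg := Finset.mem_insert.1 hg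
        · intro i
          obtain ⟨z, hz⟩ := hν i
          exact ⟨-z, by simp [hz]⟩
        · exact hG g hg, rfl⟩
    have := hcone.add_mem (hsub hx)
      (hcone.smul_mem ht (mem_coneHull_of_mem (Finset.mem_insert_self (-ν) G)))
    simpa using this
  · obtain ⟨c, hc, rfl⟩ := mem_coneHull_finset.1 hx
    by_cases hν' : -ν ∈ G
    · refine ⟨0, le_rfl, ?_⟩
      rw [hσG, zero_smul, add_zero, Finset.insert_eq_of_mem hν']
      exact mem_coneHull_finset.2 ⟨c, hc, rfl⟩
    · refine ⟨c (-ν), hc _, ?_⟩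
      rw [hσG, Finset.sum_insert hν']
      exact mem_coneHull_finset.2 ⟨c, hc, by simp⟩

theorem pairQ_toQ_sum {ι : Type*} (s : Finset ι) (z : ι → Fin n → ℤ) (p : Vec n) :
    pairQ (toQ (∑ i ∈ s, z i)) p = ∑ i ∈ s, pairQ (toQ (z i)) p := by
  have h : toQ (∑ i ∈ s, z i) = ∑ i ∈ s, toQ (z i) := by
    ext j
    simp [toQ]
  rw [h]
  exact sum_dotProduct s (fun i => toQ (z i)) p

theorem exists_forall_pairQ_pos {P : Vec n → Prop} (Q : AddSubmonoid (Fin n → ℤ))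
    (G : Finset (Vec n)) (hQ : ∀ z ∈ Q, ∀ g ∈ G, 0 ≤ pairQ (toQ z) g)
    (h : ∀ g ∈ G, P g → ∃ z ∈ Q, 0 < pairQ (toQ z) g) :
    ∃ u ∈ Q, ∀ g ∈ G, P g → 0 < pairQ (toQ u) g := by
  have h' : ∀ g ∈ G, ∃ z ∈ Q, P g → 0 < pairQ (toQ z) g := fun g hg => by
    by_cases hP : P g
    · obtain ⟨z, hz, hpos⟩ := h g hg hP
      exact ⟨z, hz, fun _ => hpos⟩
    · exact ⟨0, Q.zero_mem, fun hg => absurd hg hP⟩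
  choose! z hzQ hz using h'
  refine ⟨∑ g ∈ G, z g, Q.sum_mem hzQ, fun g hg hP => ?_⟩
  rw [pairQ_toQ_sum]
  exact Finset.sum_pos' (fun i hi => hQ _ (hzQ i hi) g hg) ⟨g, hg, hz g hg hP⟩

theorem exists_nat_forall_add_mul_nonneg {ι : Type*} (s : Finset ι) (a b : ι → ℚ) :
    ∃ N : ℕ, ∀ i ∈ s, 0 < b i → 0 ≤ a i + N * b i := by
  have h (i : ι) : ∃ N : ℕ, 0 < b i → 0 ≤ a i + N * b i := by
    obtain ⟨N, hN⟩ := exists_nat_ge (-a i / b i)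
    exact ⟨N, fun hb => by rw [div_le_iff₀ hb] at hN; linarith⟩
  choose N hN using h
  refine ⟨s.sup N, fun i hi hb => (hN i hb).trans ?_⟩
  have : N i ≤ s.sup N := Finset.le_sup hi
  gcongr

/-- An additive map on a submonoid containing an interior point extends to the whole group. -/
theorem AddSubmonoid.exists_extension {M K : Type*} [AddCommGroup M] [AddCommGroup K]
    (S : AddSubmonoid M) (u : S) (hu : ∀ z : M, ∃ N : ℕ, z + N • (u : M) ∈ S) (f : S →+ K) :
    ∃ F : M →+ K, ∀ m : S, F m = f m := by
  choose N hN using hu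
  have key (z : M) (k : ℕ) (s : S) (hs : (s : M) = z + k • (u : M)) :
      f ⟨_, hN z⟩ - N z • f u = f s - k • f u := by
    rw [sub_eq_sub_iff_add_eq_add, ← map_nsmul, ← map_nsmul, ← map_add, ← map_add]
    congr 1
    apply Subtype.ext
    simp only [AddSubmonoid.coe_add, AddSubmonoidClass.coe_nsmul, hs]
    abel
  refine ⟨AddMonoidHom.mk' (fun z => f ⟨_, hN z⟩ - N z • f u) fun a b => ?_, fun m => ?_⟩
  · rw [key (a + b) (N a + N b) (⟨_, hN a⟩ + ⟨_, hN b⟩) (by simp [add_nsmul]; abel), map_add,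
      add_nsmul]
    abel
  · exact (key m 0 m (by simp)).trans (by simp)

end Cone

section Ray

variable {n : ℕ} {σ ρ : Set (Vec n)} {ν : Vec n}

theorem IsExtremalRay.mem_ray (h : IsExtremalRay σ ρ ν) {t : ℚ} (ht : 0 ≤ t) : t • ν ∈ ρ := by
  rw [h.2.2.2.1]
  exact ⟨t, ht, rfl⟩

theorem IsExtremalRay.generator_mem (h : IsExtremalRay σ ρ ν) : ν ∈ ρ := by
  simpa using h.mem_ray zero_le_one

theorem IsExtremalRay.neg_generator_notMem (h : IsExtremalRay σ ρ ν) : -ν ∉ σ := by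
  intro hν
  have h0 : ν + -ν ∈ ρ := by simpa using h.mem_ray le_rfl
  have h1 := h.2.2.2.2.2 (-ν) hν ν (h.2.2.2.2.1 h.generator_mem) (by rwa [add_comm])
  rw [h.2.2.2.1] at h1
  obtain ⟨c, hc, hcν⟩ := h1
  have : (c + 1) • ν = 0 := by rw [add_smul, one_smul, ← hcν, neg_add_cancel]
  obtain h2 | h2 := smul_eq_zero.1 this
  · linarith
  · exact h.2.1 h2

theorem IsExtremalRay.exists_pos (hσ : IsRatPolyCone σ) (h : IsExtremalRay σ ρ ν) :
    ∃ z ∈ latticeCone σ, 0 < pairQ (toQ z) ν := by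
  obtain ⟨z, hz, hzν⟩ := hσ.exists_latticeCone_neg h.neg_generator_notMem
  exact ⟨z, hz, by rw [pairQ_neg_right] at hzν; linarith⟩

theorem latticeCone_mono {σ τ : Set (Vec n)} (h : σ ⊆ τ) : latticeCone τ ≤ latticeCone σ :=
  fun _ hz p hp => hz p (h hp)

theorem subset_addLine : σ ⊆ {x | ∃ t : ℚ, 0 ≤ t ∧ x + t • ν ∈ σ} :=
  fun x hx => ⟨0, le_rfl, by simpa using hx⟩

theorem IsExtremalRay.pairQ_eq_zero (hσ : IsRatPolyCone σ) (h : IsExtremalRay σ ρ ν)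
    {z : Fin n → ℤ} (hz : z ∈ latticeCone {x | ∃ t : ℚ, 0 ≤ t ∧ x + t • ν ∈ σ}) :
    pairQ (toQ z) ν = 0 := by
  have h1 := hz (-ν) ⟨1, zero_le_one, by simpa using hσ.zero_mem⟩
  rw [pairQ_neg_right] at h1
  exact le_antisymm (by linarith) (hz ν (subset_addLine (h.2.2.2.2.1 h.generator_mem)))

/-- Extremal rays of a polyhedral cone are exposed. -/
theorem IsExtremalRay.exists_pos_of_notMem (hσ : IsRatPolyCone σ) (h : IsExtremalRay σ ρ ν)
    {g : Vec n} (hg : g ∈ σ) (hgρ : g ∉ ρ) :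
    ∃ z ∈ latticeCone {x | ∃ t : ℚ, 0 ≤ t ∧ x + t • ν ∈ σ}, 0 < pairQ (toQ z) g := by
  obtain ⟨z, hz, hzg⟩ := (hσ.add_line h.1).exists_latticeCone_neg (x := -g) (by
    rintro ⟨t, ht, hx⟩
    refine hgρ (h.2.2.2.2.2 g hg _ hx ?_)
    simpa using h.mem_ray ht)
  exact ⟨z, hz, by rw [pairQ_neg_right] at hzg; linarith⟩

theorem isExtremalRay_primitive_dvd {w : Fin n → ℤ} (h : IsExtremalRay σ ρ (toQ w)) {d : ℤ}
    (hd : 0 < d) (hdvd : ∀ i, d ∣ w i) : d = 1 := by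
  choose k hk using hdvd
  have hd' : (0 : ℚ) < d := Int.cast_pos.2 hd
  have h1 := h.2.2.1 (d : ℚ)⁻¹ (inv_pos.2 hd') fun i => ⟨k i, by
    simp only [Pi.smul_apply, toQ, hk i, smul_eq_mul]
    push_cast
    field_simp⟩
  have h2 : (d : ℚ) ≤ 1 := (one_le_inv₀ hd').1 h1
  have h3 : d ≤ 1 := by exact_mod_cast h2
  omega

theorem IsExtremalRay.exists_pairQ_eq_neg_one (h : IsExtremalRay σ ρ ν) :
    ∃ e : Fin n → ℤ, pairQ (toQ e) ν = -1 := by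
  obtain ⟨w, rfl⟩ := h.1.exists_toQ
  obtain ⟨f, hf⟩ := Finset.gcd_eq_sum_mul Finset.univ w
  have hpos : 0 < Finset.univ.gcd w := by
    refine lt_of_le_of_ne (Int.nonneg_iff_normalize_eq_self _ |>.1 Finset.normalize_gcd)
      fun h0 => h.2.1 ?_
    ext i
    simp [toQ, Finset.gcd_eq_zero_iff.1 h0.symm i (Finset.mem_univ i)]
  have h1 := isExtremalRay_primitive_dvd h hpos fun i => Finset.gcd_dvd (Finset.mem_univ i)
  refine ⟨-f, ?_⟩
  rw [pairQ_toQ, neg_dotProduct]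
  rw [h1] at hf
  simp only [dotProduct]
  have : ∑ i, f i * w i = 1 := by rw [hf]; exact Finset.sum_congr rfl fun i _ => by ring
  rw [this]; norm_num

/-- The semigroup of degrees `S_ρ` attached to an extremal ray is nonempty. -/
theorem IsExtremalRay.exists_degree (hσ : IsRatPolyCone σ) (h : IsExtremalRay σ ρ ν) :
    ∃ e : Fin n → ℤ, pairQ (toQ e) ν = -1 ∧
      ∀ m ∈ latticeCone σ, pairQ (toQ m) ν ≠ 0 → m + e ∈ latticeCone σ := by
  obtain ⟨e, he⟩ := h.exists_pairQ_eq_neg_one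
  have hσ' := hσ
  obtain ⟨G, hG, hσG⟩ := hσ'
  have hGσ : ∀ g ∈ G, g ∈ σ := fun g hg => hσG ▸ mem_coneHull_of_mem hg
  obtain ⟨u, hu, hpos⟩ := exists_forall_pairQ_pos (P := fun g => g ∉ ρ)
    (latticeCone {x | ∃ t : ℚ, 0 ≤ t ∧ x + t • ν ∈ σ}) G
    (fun z hz g hg => hz g (subset_addLine (hGσ g hg)))
    fun g hg hP => h.exists_pos_of_notMem hσ (hGσ g hg) hP
  have huν := h.pairQ_eq_zero hσ hu
  obtain ⟨N, hN⟩ := exists_nat_forall_add_mul_nonneg G (pairQ (toQ e)) (pairQ (toQ u))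
  refine ⟨e + N • u, ?_, fun m hm hmν => ?_⟩
  · rw [toQ_add, toQ_nsmul, pairQ_add_left, pairQ_smul_left, huν, he]; norm_num
  · have hν1 : 1 ≤ pairQ (toQ m) ν := by
      have h0 : 0 ≤ pairQ (toQ m) ν := hm ν (h.2.2.2.2.1 h.generator_mem)
      obtain ⟨w, hw⟩ := h.1.exists_toQ
      rw [← hw, pairQ_toQ] at h0 hmν ⊢
      have h1 : m ⬝ᵥ w ≠ 0 := by exact_mod_cast hmν
      have h2 : 0 ≤ m ⬝ᵥ w := by exact_mod_cast h0
      exact_mod_cast (show 1 ≤ m ⬝ᵥ w by omega)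
    change toQ _ ∈ dualCone σ
    rw [hσG, mem_dualCone_coneHull]
    intro g hg
    rw [toQ_add, toQ_add, toQ_nsmul, pairQ_add_left, pairQ_add_left, pairQ_smul_left]
    by_cases hgρ : g ∈ ρ
    · rw [h.2.2.2.1] at hgρ
      obtain ⟨c, hc, rfl⟩ := hgρ
      rw [pairQ_smul_right, pairQ_smul_right, pairQ_smul_right, huν, he]
      nlinarith
    · exact add_nonneg (hm g (hGσ g hg)) (hN g hg (hpos g hg hgρ))

theorem finite_extremalRays (hσ : IsRatPolyCone σ) :
    {r : Set (Vec n) | ∃ w, IsExtremalRay σ r w}.Finite := by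
  classical
  obtain ⟨G, hG, hσG⟩ := hσ
  refine (G.finite_toSet.image fun g => {x | ∃ c : ℚ, 0 ≤ c ∧ x = c • g}).subset ?_
  rintro r ⟨w, h⟩
  have hw : w ∈ coneHull (G : Set (Vec n)) := hσG ▸ h.2.2.2.2.1 h.generator_mem
  obtain ⟨c, hc, hwc⟩ := mem_coneHull_finset.1 hw
  obtain ⟨g, hg, hne⟩ : ∃ g ∈ G, c g • g ≠ 0 := by
    by_contra! hcon
    exact h.2.1 (hwc.trans (Finset.sum_eq_zero hcon))
  have hcg : 0 < c g := lt_of_le_of_ne (hc g) fun h0 => hne (by rw [← h0, zero_smul])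
  have hmem : c g • g ∈ r := by
    refine h.2.2.2.2.2 _ ?_ (∑ x ∈ G.erase g, c x • x) ?_ ?_
    · rw [hσG]
      exact ⟨{g}, c, by simpa using hg, hc, by simp⟩
    · rw [hσG]
      exact ⟨G.erase g, c, by simp, hc, rfl⟩
    · rw [Finset.add_sum_erase G (fun x => c x • x) hg, ← hwc]
      exact h.generator_mem
  refine ⟨g, hg, ?_⟩
  rw [h.2.2.2.1] at hmem ⊢
  obtain ⟨t, ht, htw⟩ := hmem
  have htpos : 0 < t := lt_of_le_of_ne ht fun h0 => hne (by rw [htw, ← h0, zero_smul])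
  ext x
  constructor
  · rintro ⟨d, hd, rfl⟩
    refine ⟨d * ((c g)⁻¹ * t), by positivity, ?_⟩
    rw [mul_smul, mul_smul, ← htw, inv_smul_smul₀ hcg.ne']
  · rintro ⟨d, hd, rfl⟩
    refine ⟨d * (t⁻¹ * c g), by positivity, ?_⟩
    rw [mul_smul, mul_smul, htw, inv_smul_smul₀ htpos.ne']

/-- The lattice points of a pointed polyhedral cone's dual contain an interior point. -/
theorem exists_interior (hσ : IsRatPolyCone σ) (hpt : PointedCone' σ) :
    ∃ u : latticeCone σ, ∀ z : Fin n → ℤ, ∃ N : ℕ, z + N • (u : Fin n → ℤ) ∈ latticeCone σ := by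
  have hσ' := hσ
  obtain ⟨G, hG, hσG⟩ := hσ'
  have hGσ : ∀ g ∈ G, g ∈ σ := fun g hg => hσG ▸ mem_coneHull_of_mem hg
  obtain ⟨u, hu, hpos⟩ := exists_forall_pairQ_pos (P := fun g => g ≠ 0) (latticeCone σ) G
    (fun z hz g hg => hz g (hGσ g hg)) fun g hg hg0 => by
      obtain ⟨z, hz, hzg⟩ := hσ.exists_latticeCone_neg (x := -g) fun h =>
        hg0 (hpt ⟨hGσ g hg, h⟩)
      exact ⟨z, hz, by rw [pairQ_neg_right] at hzg; linarith⟩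
  refine ⟨⟨u, hu⟩, fun z => ?_⟩
  obtain ⟨N, hN⟩ := exists_nat_forall_add_mul_nonneg G (pairQ (toQ z)) (pairQ (toQ u))
  refine ⟨N, ?_⟩
  change toQ (z + N • u) ∈ dualCone σ
  rw [hσG, mem_dualCone_coneHull]
  intro g hg
  rw [toQ_add, toQ_nsmul, pairQ_add_left, pairQ_smul_left]
  by_cases hg0 : g = 0
  · subst hg0
    simp [pairQ]
  · exact hN g hg (hpos g hg hg0)

end Ray

section MonoidAlgebra

open AddMonoidAlgebra

variable {K M : Type*} [Field K] [AddCommGroup M] {S : AddSubmonoid M}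

theorem AddMonoidAlgebra.linearMap_single {V : Type*} [AddCommGroup V] [Module K V]
    (D : AddMonoidAlgebra K S →ₗ[K] V) (m : S) (r : K) :
    D (single m r) = r • D (single m 1) := by
  rw [← map_smul, smul_single, smul_eq_mul, mul_one]

/-- `D` sends each monomial `χ^m` to `c m χ^(m + e)`, where `c m = 0` unless `m + e ∈ S`. -/
def IsHomogeneousWith (D : AddMonoidAlgebra K S →ₗ[K] AddMonoidAlgebra K S) (e : M) (c : S → K) :
    Prop :=
  ∀ m : S, ∃ m' : S, D (single m 1) = single m' (c m) ∧ (c m ≠ 0 → (m' : M) = m + e)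

namespace IsHomogeneousWith

variable {D : AddMonoidAlgebra K S →ₗ[K] AddMonoidAlgebra K S} {e : M} {c : S → K}

theorem apply_eq_zero_iff (h : IsHomogeneousWith D e c) (x : AddMonoidAlgebra K S) :
    D x = 0 ↔ ∀ m, x.coeff m ≠ 0 → c m = 0 := by
  classical
  choose s hs he using h
  constructor
  · intro hx m hxm
    by_contra hcm
    have key (y : AddMonoidAlgebra K S) : (D y).coeff (s m) = y.coeff m * c m := by
      induction y using AddMonoidAlgebra.induction_linear with
      | zero => simp
      | add f g hf hg => simp [hf, hg, add_mul]
      | single a r =>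
        rw [linearMap_single, hs, smul_single, coeff_single, coeff_single, Finsupp.single_apply,
          Finsupp.single_apply]
        by_cases ham : a = m
        · simp [ham]
        · rw [if_neg ham, zero_mul, ite_eq_right_iff]
          intro hsa
          by_contra hne
          have hca : c a ≠ 0 := fun h0 => hne (by simp [h0])
          refine ham (Subtype.ext (add_right_cancel (b := e) ?_))
          rw [← he a hca, ← he m hcm, hsa]
    have := key x
    rw [hx] at this
    exact mul_ne_zero hxm hcm (by simpa using this.symm)
  · intro hx
    rw [← sum_coeff_single x, Finsupp.sum, map_sum]
    refine Finset.sum_eq_zero fun m hm => ?_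
    rw [linearMap_single, hs, hx m (Finsupp.mem_support_iff.1 hm)]
    simp

theorem exists_iterate_eq_zero (h : IsHomogeneousWith D e c) (d : S → ℕ)
    (hd : ∀ m m' : S, c m ≠ 0 → (m' : M) = m + e → d m' < d m) (x : AddMonoidAlgebra K S) :
    ∃ k : ℕ, D^[k] x = 0 := by
  have hmon (k : ℕ) : ∀ m : S, d m < k → (D ^ k) (single m (1 : K)) = 0 := by
    induction k with
    | zero => intro m hm; omega
    | succ k ih =>
      intro m hm
      obtain ⟨m', hm', he⟩ := h m
      rw [pow_succ, Module.End.mul_apply, hm']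
      by_cases hc : c m = 0
      · simp [hc]
      · rw [linearMap_single, ih m' (by have := hd m m' hc (he hc); omega), smul_zero]
  have hmono {k l : ℕ} (hkl : k ≤ l) {y : AddMonoidAlgebra K S} (hy : (D ^ k) y = 0) :
      (D ^ l) y = 0 := by
    obtain ⟨j, rfl⟩ := Nat.exists_eq_add_of_le' hkl
    rw [pow_add, Module.End.mul_apply, hy, map_zero]
  suffices ∃ k : ℕ, (D ^ k) x = 0 by simpa only [Module.End.pow_apply] using this
  induction x using AddMonoidAlgebra.induction_linear with
  | zero => exact ⟨0, by simp⟩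
  | add f g hf hg =>
    obtain ⟨k, hk⟩ := hf
    obtain ⟨l, hl⟩ := hg
    exact ⟨max k l, by rw [map_add, hmono (le_max_left _ _) hk, hmono (le_max_right _ _) hl,
      add_zero]⟩
  | single a r => exact ⟨d a + 1, by rw [linearMap_single, hmon _ a (Nat.lt_succ_self _), smul_zero]⟩

theorem exists_orbit_eq_zero (h : IsHomogeneousWith D e c)
    (hnil : ∀ x, ∃ k : ℕ, D^[k] x = 0) (m : S) :
    ∃ (j : ℕ) (m' : S), (m' : M) = m + j • e ∧ c m' = 0 := by
  have key (k : ℕ) : ∀ m : S, (D ^ k) (single m (1 : K)) = 0 →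
      ∃ (j : ℕ) (m' : S), (m' : M) = m + j • e ∧ c m' = 0 := by
    induction k with
    | zero => intro m hm; simp at hm
    | succ k ih =>
      intro m hm
      by_cases hc : c m = 0
      · exact ⟨0, m, by simp, hc⟩
      obtain ⟨m₁, hm₁, he⟩ := h m
      rw [pow_succ, Module.End.mul_apply, hm₁, linearMap_single, smul_eq_zero] at hm
      obtain ⟨j, m', hm', h0⟩ := ih m₁ (hm.resolve_left hc)
      exact ⟨j + 1, m', by rw [hm', he hc, succ_nsmul']; abel, h0⟩
  obtain ⟨k, hk⟩ := hnil (single m 1)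
  exact key k m (by rwa [Module.End.pow_apply])

end IsHomogeneousWith

/-- The derivation `χ^m ↦ φ m χ^(m + e)` of a semigroup algebra. -/
theorem exists_derivation_isHomogeneousWith (e : M) (φ : S →+ K)
    (hφ : ∀ a b : S, φ (a + b) = 0 → φ a = 0) (he : ∀ m : S, φ m ≠ 0 → (m : M) + e ∈ S) :
    ∃ D : Derivation K (AddMonoidAlgebra K S) (AddMonoidAlgebra K S),
      IsHomogeneousWith (D : AddMonoidAlgebra K S →ₗ[K] AddMonoidAlgebra K S) e φ := by
  have hs (m : S) : ∃ m' : S, φ m ≠ 0 → (m' : M) = m + e := by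
    by_cases h : φ m = 0
    · exact ⟨0, fun h' => absurd h h'⟩
    · exact ⟨⟨_, he m h⟩, fun _ => rfl⟩
  choose s hs using hs
  let L : AddMonoidAlgebra K S →ₗ[K] AddMonoidAlgebra K S :=
    Finsupp.linearCombination K (fun m => single (s m) (φ m)) ∘ₗ
      (coeffLinearEquiv K).toLinearMap
  have hL (m : S) (r : K) : L (single m r) = single (s m) (r * φ m) := by
    simp [L, Finsupp.linearCombination_single, smul_single]
  have hshift (a b : S) (r : K) : single (b + s a) (r * φ a) = single (s (a + b)) (r * φ a) := by
    by_cases ha : φ a = 0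
    · simp [ha]
    · congr 1
      apply Subtype.ext
      rw [AddSubmonoid.coe_add, hs a ha, hs (a + b) fun h0 => ha (hφ a b h0)]
      simp only [AddSubmonoid.coe_add]
      abel
  have hleib (x y : AddMonoidAlgebra K S) : L (x * y) = x • L y + y • L x := by
    induction x using AddMonoidAlgebra.induction_linear with
    | zero => simp
    | add f g hf hg => rw [add_mul, map_add, hf, hg, map_add]; simp only [smul_eq_mul]; ring
    | single a r =>
      induction y using AddMonoidAlgebra.induction_linear with
      | zero => simp
      | add f g hf hg => rw [mul_add, map_add, hf, hg, map_add]; simp only [smul_eq_mul]; ring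
      | single b t =>
        simp only [smul_eq_mul, hL, single_mul_single, map_add]
        rw [← mul_assoc, ← mul_assoc, hshift, hshift, add_comm b a, ← single_add]
        congr 1
        ring
  exact ⟨Derivation.mk' L hleib, fun m => ⟨s m, (hL m 1).trans (by rw [one_mul]), hs m⟩⟩

theorem Derivation.eq_zero_of_single
    {D : Derivation K (AddMonoidAlgebra K S) (AddMonoidAlgebra K S)}
    (h : ∀ m : S, D (single m 1) = 0) : D = 0 := by
  ext x
  have hD : IsHomogeneousWith (D : AddMonoidAlgebra K S →ₗ[K] AddMonoidAlgebra K S) (0 : M) 0 :=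
    fun m => ⟨m, by simpa using h m, by simp⟩
  simp [show D x = 0 from (hD.apply_eq_zero_iff x).2 fun _ _ => rfl]

/-- A nonzero derivation sending monomials to terms has a well-defined degree. -/
theorem Derivation.exists_isHomogeneousWith
    {D : Derivation K (AddMonoidAlgebra K S) (AddMonoidAlgebra K S)} (hD : D ≠ 0)
    (h : ∀ m : S, ∃ (m' : S) (c : K), D (single m 1) = single m' c) :
    ∃ (e : M) (f : S →+ K), (∃ m, f m ≠ 0) ∧
      IsHomogeneousWith (D : AddMonoidAlgebra K S →ₗ[K] AddMonoidAlgebra K S) e f := by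
  classical
  choose s c hsc using h
  have hleib (a b : S) : (single (s (a + b)) (c (a + b)) : AddMonoidAlgebra K S) =
      single (a + s b) (c b) + single (b + s a) (c a) := by
    have := D.leibniz (single a (1 : K)) (single b 1)
    simpa [single_mul_single, hsc] using this
  have hadd (a b : S) : c (a + b) = c a + c b := by
    have := congrArg (fun x => Finsupp.linearCombination K (fun _ : S => (1 : K)) x.coeff)
      (hleib a b)
    simpa [add_comm] using this
  obtain ⟨m₀, hm₀⟩ : ∃ m, c m ≠ 0 := by
    by_contra! hc
    exact hD (Derivation.eq_zero_of_single fun m => by rw [hsc, hc, single_zero])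
  refine ⟨s m₀ - m₀, AddMonoidHom.mk' c hadd, ⟨m₀, hm₀⟩, fun m => ⟨s m, hsc m, fun hm => ?_⟩⟩
  have heq : m + s m₀ = m₀ + s m := by
    by_contra hne
    have h1 := congrArg (fun x => x.coeff (m + s m₀)) (hleib m m₀)
    have h2 := congrArg (fun x => x.coeff (m₀ + s m)) (hleib m m₀)
    simp only [coeff_single, coeff_add, Finsupp.add_apply, Finsupp.single_apply, if_true,
      if_neg hne, if_neg (Ne.symm hne), add_zero, zero_add] at h1 h2
    have e1 : s (m + m₀) = m + s m₀ := by
      by_contra h'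
      exact hm₀ (by simpa [h'] using h1.symm)
    have e2 : s (m + m₀) = m₀ + s m := by
      by_contra h'
      exact hm (by simpa [h'] using h2.symm)
    exact hne (e1.symm.trans e2)
  have := congrArg (Subtype.val) heq
  simp only [AddSubmonoid.coe_add] at this
  rw [← add_sub_assoc, this, add_sub_cancel_left]

end MonoidAlgebra

section Toric

variable {n : ℕ} {σ ρ ρ' : Set (Vec n)} {ν ν' : Vec n} {K : Type*} [Field K]

/-- The span `K[τ ∩ M]` of the monomials orthogonal to `ν`, for the facet `τ = σ^∨ ∩ ν^⊥`. -/
def facetAlgebra (K : Type*) [Field K] (σ : Set (Vec n)) (ν : Vec n) :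
    Set (AddMonoidAlgebra K (latticeCone σ)) :=
  {x | ∀ m, x.coeff m ≠ 0 → pairQ (toQ (m : Fin n → ℤ)) ν = 0}

theorem IsHomogeneousWith.ker_eq_facetAlgebra
    {D : AddMonoidAlgebra K (latticeCone σ) →ₗ[K] AddMonoidAlgebra K (latticeCone σ)}
    {e : Fin n → ℤ} {c : latticeCone σ → K} (h : IsHomogeneousWith D e c)
    (hc : ∀ m, c m = 0 ↔ pairQ (toQ (m : Fin n → ℤ)) ν = 0) :
    {x | D x = 0} = facetAlgebra K σ ν := by
  ext x
  simp only [Set.mem_ofPred_eq, facetAlgebra, h.apply_eq_zero_iff, hc]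

theorem IsExtremalRay.generator_eq (h : IsExtremalRay σ ρ ν) (h' : IsExtremalRay σ ρ ν') :
    ν = ν' := by
  have hmem : ν ∈ ρ := h.generator_mem
  have hmem' : ν' ∈ ρ := h'.generator_mem
  rw [h'.2.2.2.1] at hmem
  rw [h.2.2.2.1] at hmem'
  obtain ⟨c, hc, rfl⟩ := hmem
  obtain ⟨d, hd, hd'⟩ := hmem'
  have hc0 : 0 < c := lt_of_le_of_ne hc fun h0 => h.2.1 (by rw [← h0, zero_smul])
  have hd0 : 0 < d := lt_of_le_of_ne hd fun h0 => h'.2.1 (by rw [hd', ← h0, zero_smul])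
  have h1 := h'.2.2.1 c hc0 h.1
  have h2 := h.2.2.1 d hd0 (hd' ▸ h'.1)
  have hdc : (d * c - 1) • ν' = 0 := by
    rw [sub_smul, mul_smul, ← hd', one_smul, sub_self]
  have h3 : d * c = 1 := sub_eq_zero.1 ((smul_eq_zero.1 hdc).resolve_right h'.2.1)
  have : c = 1 := by nlinarith
  rw [this, one_smul]

theorem IsExtremalRay.facetAlgebra_injective (hσ : IsRatPolyCone σ) (h : IsExtremalRay σ ρ ν)
    (h' : IsExtremalRay σ ρ' ν') (heq : facetAlgebra K σ ν = facetAlgebra K σ ν') : ρ = ρ' := by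
  have hmem : ν' ∈ ρ := by
    by_contra hν'
    obtain ⟨z, hz, hpos⟩ := h.exists_pos_of_notMem hσ (h'.2.2.2.2.1 h'.generator_mem) hν'
    let m : latticeCone σ := ⟨z, latticeCone_mono subset_addLine hz⟩
    have hm : AddMonoidAlgebra.single m (1 : K) ∈ facetAlgebra K σ ν := by
      intro a ha
      rw [AddMonoidAlgebra.coeff_single, Finsupp.single_apply_ne_zero] at ha
      rw [ha.1]
      exact h.pairQ_eq_zero hσ hz
    rw [heq] at hm
    exact hpos.ne' (hm m (by simp))
  have hmem' := hmem
  rw [h.2.2.2.1] at hmem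
  obtain ⟨c, hc, rfl⟩ := hmem
  have hc0 : 0 < c := lt_of_le_of_ne hc fun h0 => h'.2.1 (by rw [← h0, zero_smul])
  rw [h.2.2.2.1, h'.2.2.2.1]
  ext x
  constructor
  · rintro ⟨d, hd, rfl⟩
    exact ⟨d * c⁻¹, by positivity, by rw [mul_smul, inv_smul_smul₀ hc0.ne']⟩
  · rintro ⟨d, hd, rfl⟩
    exact ⟨d * c, by positivity, by rw [mul_smul]⟩

/-- The pairing with `ν`, as a `K`-valued additive function on the lattice points of `σ^∨`. -/
def pairingHom (K : Type*) [Field K] [CharZero K] (σ : Set (Vec n)) (ν : Vec n) :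
    latticeCone σ →+ K :=
  AddMonoidHom.mk' (fun m => algebraMap ℚ K (pairQ (toQ (m : Fin n → ℤ)) ν)) fun a b => by
    rw [AddSubmonoid.coe_add, toQ_add, pairQ_add_left, map_add]

variable [CharZero K]

theorem pairingHom_eq_zero_iff (m : latticeCone σ) :
    pairingHom K σ ν m = 0 ↔ pairQ (toQ (m : Fin n → ℤ)) ν = 0 :=
  map_eq_zero (algebraMap ℚ K)

theorem isHomogeneousWith_of_apply_single {e : Fin n → ℤ} {lam : K}
    {D : Derivation K (AddMonoidAlgebra K (latticeCone σ)) (AddMonoidAlgebra K (latticeCone σ))}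
    (he : ∀ m : Fin n → ℤ, toQ m ∈ dualCone σ → pairQ (toQ m) ν ≠ 0 → toQ (m + e) ∈ dualCone σ)
    (hD : ∀ m m' : latticeCone σ, (m' : Fin n → ℤ) = (m : Fin n → ℤ) + e →
      D (AddMonoidAlgebra.single m (1 : K)) =
        (lam * algebraMap ℚ K (pairQ (toQ m) ν)) • AddMonoidAlgebra.single m' (1 : K))
    (hD0 : ∀ m : latticeCone σ, pairQ (toQ m) ν = 0 →
      D (AddMonoidAlgebra.single m (1 : K)) = 0) :
    IsHomogeneousWith
      (D : AddMonoidAlgebra K (latticeCone σ) →ₗ[K] AddMonoidAlgebra K (latticeCone σ)) e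
      (fun m => lam * algebraMap ℚ K (pairQ (toQ m) ν)) := by
  intro m
  by_cases hm : pairQ (toQ (m : Fin n → ℤ)) ν = 0
  · exact ⟨0, by simpa [hm] using hD0 m hm, by simp [hm]⟩
  · refine ⟨⟨_, he m m.2 hm⟩, ?_, fun _ => rfl⟩
    refine (hD m ⟨_, he m m.2 hm⟩ rfl).trans ?_
    rw [AddMonoidAlgebra.smul_single, smul_eq_mul, mul_one]

theorem IsExtremalRay.exists_isLND (hσ : IsRatPolyCone σ) (h : IsExtremalRay σ ρ ν) :
    ∃ Δ : Derivation K (AddMonoidAlgebra K (latticeCone σ)) (AddMonoidAlgebra K (latticeCone σ)),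
      Δ ≠ 0 ∧ IsLND Δ ∧
      (∀ m : latticeCone σ, ∃ (m' : latticeCone σ) (c : K),
        Δ (AddMonoidAlgebra.single m (1 : K)) = AddMonoidAlgebra.single m' c) ∧
      {x | Δ x = 0} = facetAlgebra K σ ν := by
  obtain ⟨e, heν, he⟩ := h.exists_degree hσ
  have hνσ : ν ∈ σ := h.2.2.2.2.1 h.generator_mem
  obtain ⟨D, hD⟩ := exists_derivation_isHomogeneousWith e (pairingHom K σ ν)
    (fun a b hab => by
      rw [pairingHom_eq_zero_iff] at hab ⊢
      rw [AddSubmonoid.coe_add, toQ_add, pairQ_add_left] at hab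
      have ha := a.2 ν hνσ
      have hb := b.2 ν hνσ
      linarith)
    (fun m hm => he m m.2 ((pairingHom_eq_zero_iff m).not.1 hm))
  have hker := hD.ker_eq_facetAlgebra pairingHom_eq_zero_iff
  refine ⟨D, ?_, ?_, fun m => ?_, hker⟩
  · rintro rfl
    obtain ⟨z, hz, hpos⟩ := h.exists_pos hσ
    have hmem : AddMonoidAlgebra.single (⟨z, hz⟩ : latticeCone σ) (1 : K) ∈
        facetAlgebra K σ ν := by
      rw [← hker]
      simp
    exact hpos.ne' (hmem ⟨z, hz⟩ (by simp))
  · obtain ⟨w, rfl⟩ := h.1.exists_toQ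
    refine hD.exists_iterate_eq_zero (fun m => ((m : Fin n → ℤ) ⬝ᵥ w).toNat) fun m m' hm hm' => ?_
    rw [Ne, pairingHom_eq_zero_iff, pairQ_toQ] at hm
    have h0 := m.2 _ hνσ
    rw [pairQ_toQ] at h0
    rw [pairQ_toQ] at heν
    have h0' : 0 ≤ (m : Fin n → ℤ) ⬝ᵥ w := by exact_mod_cast h0
    have hm0 : (m : Fin n → ℤ) ⬝ᵥ w ≠ 0 := by exact_mod_cast hm
    have he1 : e ⬝ᵥ w = -1 := by exact_mod_cast heν
    simp only [hm', add_dotProduct, he1]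
    omega
  · obtain ⟨m', hm', -⟩ := hD m
    exact ⟨m', _, hm'⟩

/-- Every nonzero homogeneous locally nilpotent derivation is attached to an extremal ray. -/
theorem exists_isExtremalRay_of_isLND (hσ : IsRatPolyCone σ) (hpt : PointedCone' σ)
    {Δ : Derivation K (AddMonoidAlgebra K (latticeCone σ)) (AddMonoidAlgebra K (latticeCone σ))}
    (hΔ : Δ ≠ 0) (hnil : IsLND Δ)
    (hhom : ∀ m : latticeCone σ, ∃ (m' : latticeCone σ) (c : K),
      Δ (AddMonoidAlgebra.single m (1 : K)) = AddMonoidAlgebra.single m' c) :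
    ∃ (r : Set (Vec n)) (w : Vec n), IsExtremalRay σ r w ∧
      {x | Δ x = 0} = facetAlgebra K σ w := by
  obtain ⟨e, f, ⟨m₀, hm₀⟩, hf⟩ := Derivation.exists_isHomogeneousWith hΔ hhom
  obtain ⟨u, hu⟩ := exists_interior hσ hpt
  obtain ⟨F, hF⟩ := (latticeCone σ).exists_extension u hu f
  have horbit (m : latticeCone σ) : ∃ j : ℕ, f m = j * (-F e) := by
    obtain ⟨j, m', hm', h0⟩ := hf.exists_orbit_eq_zero hnil m
    refine ⟨j, ?_⟩
    rw [← hF m', hm', map_add, map_nsmul, hF, nsmul_eq_mul] at h0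
    linear_combination h0
  have hFe : F e ≠ 0 := fun h0 => by
    obtain ⟨j, hj⟩ := horbit m₀
    exact hm₀ (by rw [hj, h0]; simp)
  have hint (z : Fin n → ℤ) : ∃ k : ℤ, F z = k * (-F e) := by
    obtain ⟨N, hN⟩ := hu z
    obtain ⟨i, hi⟩ := horbit ⟨_, hN⟩
    obtain ⟨j, hj⟩ := horbit u
    rw [← hF, map_add, map_nsmul, hF, hj, nsmul_eq_mul] at hi
    exact ⟨i - N * j, by push_cast; linear_combination hi⟩
  choose k hk using hint
  let w : Fin n → ℤ := fun i => k (Pi.single i 1)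
  have hFw (z : Fin n → ℤ) : F z = ((z ⬝ᵥ w : ℤ) : K) * (-F e) := by
    have hz : z = ∑ i, z i • (Pi.single i 1 : Fin n → ℤ) := by
      ext j
      simp [Pi.single_apply]
    conv_lhs => rw [hz, map_sum]
    simp only [dotProduct, Int.cast_sum, Int.cast_mul, Finset.sum_mul]
    refine Finset.sum_congr rfl fun i _ => ?_
    rw [map_zsmul, hk, zsmul_eq_mul, mul_assoc]
  have hew : e ⬝ᵥ w = -1 := by
    have h1 : (((e ⬝ᵥ w : ℤ) : K) + 1) * (-F e) = 0 := by
      have := hFw e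
      linear_combination -this
    have h2 := (mul_eq_zero.1 h1).resolve_right (neg_ne_zero.2 hFe)
    have h3 : e ⬝ᵥ w + 1 = 0 := by exact_mod_cast h2
    omega
  have heq : pairQ (toQ e) (toQ w) = -1 := by rw [pairQ_toQ, hew]; norm_num
  have hf0 (m : latticeCone σ) : f m = 0 ↔ pairQ (toQ (m : Fin n → ℤ)) (toQ w) = 0 := by
    rw [← hF, hFw, mul_eq_zero, or_iff_left (neg_ne_zero.2 hFe), pairQ_toQ, Int.cast_eq_zero,
      Int.cast_eq_zero]
  have hwσ : toQ w ∈ σ := hσ.mem_of_forall_latticeCone fun z hz => by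
    obtain ⟨j, hj⟩ := horbit ⟨z, hz⟩
    rw [← hF, hFw] at hj
    have h1 := mul_right_cancel₀ (neg_ne_zero.2 hFe) hj
    have h2 : z ⬝ᵥ w = j := by exact_mod_cast h1
    rw [pairQ_toQ, h2]
    simp
  have hshift (m : latticeCone σ) (hm : pairQ (toQ (m : Fin n → ℤ)) (toQ w) ≠ 0) :
      (m : Fin n → ℤ) + e ∈ latticeCone σ := by
    obtain ⟨m', -, hm'⟩ := hf m
    rw [← hm' ((hf0 m).not.2 hm)]
    exact m'.2
  have hproj {p : Vec n} (hp : p ∈ σ) : p + pairQ (toQ e) p • toQ w ∈ σ := by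
    have hmul (d : ℕ) : ∀ m ∈ latticeCone σ, m ⬝ᵥ w = d → m + d • e ∈ latticeCone σ := by
      induction d with
      | zero => intro m hm _; simpa using hm
      | succ d ih =>
        intro m hm hd
        have h1 := hshift ⟨m, hm⟩ (by rw [pairQ_toQ, hd]; positivity)
        have h2 := ih (m + e) h1 (by rw [add_dotProduct, hd, hew]; push_cast; ring)
        rwa [add_assoc, ← succ_nsmul'] at h2
    refine hσ.mem_of_forall_latticeCone fun z hz => ?_
    have hz0 := hz _ hwσ
    rw [pairQ_toQ] at hz0
    have hz1 : 0 ≤ z ⬝ᵥ w := by exact_mod_cast hz0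
    obtain ⟨d, hd⟩ := Int.eq_ofNat_of_zero_le hz1
    have h1 := hmul d z hz hd p hp
    rw [toQ_add, toQ_nsmul, pairQ_add_left, pairQ_smul_left] at h1
    rw [pairQ_add_right, pairQ_smul_right, pairQ_toQ, hd]
    push_cast
    linarith
  have hw0 : toQ w ≠ 0 := fun h0 => by
    rw [h0] at heq
    simp [pairQ] at heq
  refine ⟨_, toQ w, ⟨isLatticeVec_toQ w, hw0, fun c hc hcw => ?_, rfl, ?_, ?_⟩,
    hf.ker_eq_facetAlgebra hf0⟩
  · obtain ⟨v, hv⟩ := hcw.exists_toQ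
    have h1 : pairQ (toQ e) (toQ v) = -c := by rw [hv, pairQ_smul_right, heq]; ring
    rw [pairQ_toQ] at h1
    have h2 : c = ((-(e ⬝ᵥ v) : ℤ) : ℚ) := by push_cast; linarith
    rw [h2] at hc ⊢
    have h3 : 0 < -(e ⬝ᵥ v) := by exact_mod_cast hc
    exact_mod_cast (show 1 ≤ -(e ⬝ᵥ v) by omega)
  · rintro _ ⟨c, hc, rfl⟩
    exact hσ.smul_mem hc hwσ
  · rintro x hx y hy ⟨c, hc, hxy⟩
    have hsum : (x + pairQ (toQ e) x • toQ w) + (y + pairQ (toQ e) y • toQ w) = 0 := by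
      have h1 : pairQ (toQ e) x + pairQ (toQ e) y = -c := by
        rw [← pairQ_add_right, hxy, pairQ_smul_right, heq]; ring
      rw [add_add_add_comm, ← add_smul, h1, hxy, neg_smul, add_neg_cancel]
    have hx0 : x + pairQ (toQ e) x • toQ w = 0 := by
      refine hpt ⟨hproj hx, ?_⟩
      rw [Set.mem_neg, neg_eq_of_add_eq_zero_right hsum]
      exact hproj hy
    have hxw : x = (-pairQ (toQ e) x) • toQ w := by
      rw [neg_smul]
      exact eq_neg_of_add_eq_zero_left hx0
    refine ⟨-pairQ (toQ e) x, ?_, hxw⟩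
    by_contra! hneg
    refine hw0 (hpt ⟨hwσ, ?_⟩)
    have h1 : -toQ w = (pairQ (toQ e) x)⁻¹ • x := by
      rw [eq_inv_smul_iff₀ (by linarith), smul_neg, ← neg_smul]
      exact hxw.symm
    rw [Set.mem_neg, h1]
    exact hσ.smul_mem (inv_nonneg.2 (by linarith)) hx

end Toric

open AddMonoidAlgebra in
/-- Corollary 2.12 (toric-neq): two nonzero homogeneous LNDs `λ∂_{ρ,e}` and
`λ'∂_{ρ',e'}` on `A = K[σ^∨ ∩ M]` have equal kernels iff `ρ = ρ'`; in particular the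
set of kernels of nonzero homogeneous LNDs on `A` is finite and equinumerous with the
set of extremal rays of `σ`. -/
theorem stmt10 {n : ℕ} (K : Type*) [Field K] [CharZero K]
    (σ ρ ρ' : Set (Vec n)) (ν ν' : Vec n)
    (hσ : IsRatPolyCone σ) (hpt : PointedCone' σ) (hfull : FullDim σ)
    (hρ : IsExtremalRay σ ρ ν) (hρ' : IsExtremalRay σ ρ' ν')
    (e e' : Fin n → ℤ)
    (he₁ : toQ e ∉ dualCone σ)
    (he₂ : ∀ m : Fin n → ℤ, toQ m ∈ dualCone σ → pairQ (toQ m) ν ≠ 0 →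
      toQ (m + e) ∈ dualCone σ)
    (he'₁ : toQ e' ∉ dualCone σ)
    (he'₂ : ∀ m : Fin n → ℤ, toQ m ∈ dualCone σ → pairQ (toQ m) ν' ≠ 0 →
      toQ (m + e') ∈ dualCone σ)
    (lam lam' : K) (hlam : lam ≠ 0) (hlam' : lam' ≠ 0)
    (D D' : Derivation K (AddMonoidAlgebra K ↥(latticeCone σ))
        (AddMonoidAlgebra K ↥(latticeCone σ)))
    (hD : ∀ (m m' : latticeCone σ), (m' : Fin n → ℤ) = (m : Fin n → ℤ) + e →
      D (single m (1 : K)) = (lam * algebraMap ℚ K (pairQ (toQ m) ν)) • single m' (1 : K))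
    (hD0 : ∀ m : latticeCone σ, pairQ (toQ m) ν = 0 → D (single m (1 : K)) = 0)
    (hD' : ∀ (m m' : latticeCone σ), (m' : Fin n → ℤ) = (m : Fin n → ℤ) + e' →
      D' (single m (1 : K)) = (lam' * algebraMap ℚ K (pairQ (toQ m) ν')) • single m' (1 : K))
    (hD'0 : ∀ m : latticeCone σ, pairQ (toQ m) ν' = 0 → D' (single m (1 : K)) = 0) :
    ({x | D x = 0} = {x | D' x = 0} ↔ ρ = ρ') ∧
    ({S : Set (AddMonoidAlgebra K ↥(latticeCone σ)) |
        ∃ Δ : Derivation K (AddMonoidAlgebra K ↥(latticeCone σ))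
          (AddMonoidAlgebra K ↥(latticeCone σ)),
        Δ ≠ 0 ∧ IsLND Δ ∧
        (∀ m : latticeCone σ, ∃ (m' : latticeCone σ) (c : K),
          Δ (single m (1 : K)) = single m' c) ∧
        S = {x | Δ x = 0}}.Finite ∧
      Nonempty
        ({S : Set (AddMonoidAlgebra K ↥(latticeCone σ)) |
          ∃ Δ : Derivation K (AddMonoidAlgebra K ↥(latticeCone σ))
            (AddMonoidAlgebra K ↥(latticeCone σ)),
          Δ ≠ 0 ∧ IsLND Δ ∧
          (∀ m : latticeCone σ, ∃ (m' : latticeCone σ) (c : K),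
            Δ (single m (1 : K)) = single m' c) ∧
          S = {x | Δ x = 0}} ≃
        {r : Set (Vec n) | ∃ w : Vec n, IsExtremalRay σ r w})) := by
  have hker := (isHomogeneousWith_of_apply_single he₂ hD hD0).ker_eq_facetAlgebra
    (ν := ν) fun m => by simp [hlam]
  have hker' := (isHomogeneousWith_of_apply_single he'₂ hD' hD'0).ker_eq_facetAlgebra
    (ν := ν') fun m => by simp [hlam']
  have hkernels : {S : Set (AddMonoidAlgebra K ↥(latticeCone σ)) |
      ∃ Δ : Derivation K (AddMonoidAlgebra K ↥(latticeCone σ))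
        (AddMonoidAlgebra K ↥(latticeCone σ)),
      Δ ≠ 0 ∧ IsLND Δ ∧
      (∀ m : latticeCone σ, ∃ (m' : latticeCone σ) (c : K),
        Δ (single m (1 : K)) = single m' c) ∧
      S = {x | Δ x = 0}} = {S | ∃ r w, IsExtremalRay σ r w ∧ S = facetAlgebra K σ w} := by
    ext S
    constructor
    · rintro ⟨Δ, hΔ, hnil, hhom, rfl⟩
      exact exists_isExtremalRay_of_isLND hσ hpt hΔ hnil hhom
    · rintro ⟨r, w, hw, rfl⟩
      obtain ⟨Δ, hΔ, hnil, hhom, hkerΔ⟩ := hw.exists_isLND (K := K) hσ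
      exact ⟨Δ, hΔ, hnil, hhom, hkerΔ.symm⟩
  rw [hkernels]
  let φ : {r : Set (Vec n) | ∃ w : Vec n, IsExtremalRay σ r w} →
      {S | ∃ r w, IsExtremalRay σ r w ∧ S = facetAlgebra K σ w} :=
    fun r => ⟨facetAlgebra K σ r.2.choose, r, r.2.choose, r.2.choose_spec, rfl⟩
  have hφ : φ.Bijective := by
    refine ⟨fun r r' h => Subtype.ext ?_, ?_⟩
    · exact r.2.choose_spec.facetAlgebra_injective hσ r'.2.choose_spec (congrArg Subtype.val h)
    · rintro ⟨S, r, w, hw, rfl⟩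
      have hr : ∃ w, IsExtremalRay σ r w := ⟨w, hw⟩
      refine ⟨⟨r, hr⟩, Subtype.ext ?_⟩
      exact congrArg (facetAlgebra K σ) (hr.choose_spec.generator_eq hw)
  have := (finite_extremalRays hσ).to_subtype
  refine ⟨⟨fun h => ?_, ?_⟩, Set.finite_coe_iff.1 (Finite.of_surjective φ hφ.2), ⟨(Equiv.ofBijective φ hφ).symm⟩⟩
  · exact hρ.facetAlgebra_injective hσ hρ' (hker.symm.trans (h.trans hker'))
  · rintro rfl
    obtain rfl := hρ.generator_eq hρ'
    exact hker.trans hker'.symm
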